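/- Let P be a convex polytope in ℝⁿ (n ≥ 2) with affine span Φ a proper affine subspace of ℝⁿ, where P has codimension at least 2, or codimension 1 with P ≠ Φ. Endow ∂N_R(P) with its length metric d_ℓ. Let x, y ∈ ∂N_R(P) with projections x', y' on Φ such that the segment [x', y'] meets P, and suppose Φ has codimension at least 2, or has codimension 1 and does not separate x and y. Then there exist universal constants k₁, k₂ > 0 (independent of x, y, P, R) with k₁ · d(x,y) ≤ d_ℓ(x,y) ≤ k₂ · d(x,y). -/

import Mathlib

open Metric
open scoped ENNReal RealInnerProductSpace

/-- The length (intrinsic) metric on a subset `S` of a metric space. -/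
noncomputable def lengthDist {E : Type*} [MetricSpace E] (S : Set E) (x y : E) : ℝ≥0∞ :=
  ⨅ (γ : ℝ → E) (_ : ContinuousOn γ (Set.Icc 0 1)) (_ : γ 0 = x) (_ : γ 1 = y)
    (_ : ∀ t ∈ Set.Icc (0:ℝ) 1, γ t ∈ S), eVariationOn γ (Set.Icc 0 1)

/-- A convex polyhedron: an intersection of finitely many closed half-spaces. -/
def IsPolyhedron {n : ℕ} (P : Set (EuclideanSpace ℝ (Fin n))) : Prop :=
  ∃ (k : ℕ) (v : Fin k → EuclideanSpace ℝ (Fin n)) (c : Fin k → ℝ),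
    P = {x | ∀ i, ⟪v i, x⟫ ≤ c i}

section LengthDist

variable {E : Type*}

theorem lengthDist_le [MetricSpace E] {S : Set E} {x y : E} {γ : ℝ → E}
    (hc : ContinuousOn γ (Set.Icc 0 1)) (h0 : γ 0 = x) (h1 : γ 1 = y)
    (hS : ∀ t ∈ Set.Icc (0 : ℝ) 1, γ t ∈ S) :
    lengthDist S x y ≤ eVariationOn γ (Set.Icc 0 1) :=
  iInf_le_of_le γ <| iInf_le_of_le hc <| iInf_le_of_le h0 <| iInf_le_of_le h1 <| iInf_le _ hS

theorem edist_le_lengthDist [MetricSpace E] (S : Set E) (x y : E) :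
    edist x y ≤ lengthDist S x y := by
  refine le_iInf fun γ => le_iInf fun _ => le_iInf fun h0 => le_iInf fun h1 => le_iInf fun _ => ?_
  rw [← h0, ← h1]
  exact eVariationOn.edist_le γ (by simp) (by simp)

theorem lengthDist_triangle [MetricSpace E] (S : Set E) (x y z : E) :
    lengthDist S x z ≤ lengthDist S x y + lengthDist S y z := by
  conv_rhs => simp only [lengthDist, ENNReal.iInf_add, ENNReal.add_iInf]
  refine le_iInf fun δ => le_iInf fun hδ => le_iInf fun hδ0 => le_iInf fun hδ1 =>
    le_iInf fun hδS => le_iInf fun γ => le_iInf fun hγ => le_iInf fun hγ0 => le_iInf fun hγ1 =>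
    le_iInf fun hγS => ?_
  let η : ℝ → E := fun t => if t ≤ 1 / 2 then γ (2 * t) else δ (2 * t - 1)
  have hηl : Set.EqOn η (γ ∘ fun t => 2 * t) (Set.Icc 0 (1 / 2)) := fun t ht => if_pos ht.2
  have hηr : Set.EqOn η (δ ∘ fun t => 2 * t - 1) (Set.Icc (1 / 2) 1) := by
    intro t ht
    rcases ht.1.eq_or_lt with h | h
    · simp [η, ← h, hγ1, hδ0]
    · exact if_neg (not_le.2 h)
  have hml : Set.MapsTo (fun t : ℝ => 2 * t) (Set.Icc 0 (1 / 2)) (Set.Icc 0 1) :=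
    fun t ht => ⟨by linarith [ht.1], by linarith [ht.2]⟩
  have hmr : Set.MapsTo (fun t : ℝ => 2 * t - 1) (Set.Icc (1 / 2) 1) (Set.Icc 0 1) :=
    fun t ht => ⟨by linarith [ht.1], by linarith [ht.2]⟩
  have hunion : Set.Icc (0 : ℝ) (1 / 2) ∪ Set.Icc (1 / 2) 1 = Set.Icc 0 1 :=
    Set.Icc_union_Icc_eq_Icc (by norm_num) (by norm_num)
  have hcont : ContinuousOn η (Set.Icc 0 1) := by
    rw [← hunion]
    exact ((hγ.comp (by fun_prop) hml).congr hηl).union_of_isClosed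
      ((hδ.comp (by fun_prop) hmr).congr hηr) isClosed_Icc isClosed_Icc
  have hmem : ∀ t ∈ Set.Icc (0 : ℝ) 1, η t ∈ S := by
    intro t ht
    rw [← hunion] at ht
    rcases ht with ht | ht
    · rw [hηl ht]; exact hγS _ (hml ht)
    · rw [hηr ht]; exact hδS _ (hmr ht)
  refine (lengthDist_le hcont (by simp [η, hγ0]) (by norm_num [η, hδ1]) hmem).trans ?_
  have hsplit := eVariationOn.Icc_add_Icc η (s := Set.univ) (a := 0) (b := 1 / 2) (c := 1)
    (by norm_num) (by norm_num) (Set.mem_univ _)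
  simp only [Set.univ_inter] at hsplit
  rw [← hsplit, eVariationOn.congr hηl, eVariationOn.congr hηr]
  refine add_le_add ?_ ?_
  · exact eVariationOn.comp_le_of_monotoneOn γ _ (fun a _ b _ h => by linarith) hml
  · exact eVariationOn.comp_le_of_monotoneOn δ _ (fun a _ b _ h => by linarith) hmr

theorem lengthDist_le_of_segment_subset [NormedAddCommGroup E] [NormedSpace ℝ E] {S : Set E}
    {x y : E} (h : segment ℝ x y ⊆ S) : lengthDist S x y ≤ ENNReal.ofReal (dist x y) := by
  have hL : LipschitzWith (nndist x y) (AffineMap.lineMap x y : ℝ → E) := lipschitzWith_lineMap x y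
  refine (lengthDist_le (γ := AffineMap.lineMap x y) hL.continuous.continuousOn
    (by simp) (by simp) fun t ht => h ?_).trans ?_
  · rw [segment_eq_image_lineMap]
    exact Set.mem_image_of_mem _ ht
  · have h1 := (hL.lipschitzOnWith (s := Set.univ)).comp_eVariationOn_le
      (g := (id : ℝ → ℝ)) (s := Set.Icc 0 1) (Set.mapsTo_univ _ _)
    have h2 := (monotone_id (α := ℝ)).monotoneOn Set.univ |>.eVariationOn_eq
      (Set.mem_univ 0) (Set.mem_univ 1)
    simp only [Set.univ_inter, id, sub_zero, ENNReal.ofReal_one] at h2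
    calc _ ≤ (nndist x y : ℝ≥0∞) * 1 := h1.trans (by rw [h2])
      _ = _ := by rw [mul_one, ← edist_nndist, edist_dist]

theorem lengthDist_add_left_le [NormedAddCommGroup E] [NormedSpace ℝ E] {S : Set E}
    {q a b : E} (h : ∀ w ∈ segment ℝ a b, q + w ∈ S) :
    lengthDist S (q + a) (q + b) ≤ ENNReal.ofReal ‖a - b‖ := by
  rw [← dist_eq_norm, ← dist_add_left q a b]
  refine lengthDist_le_of_segment_subset ?_
  rw [← segment_translate_image]
  rintro _ ⟨w, hw, rfl⟩
  exact h w hw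

end LengthDist

section Projection

variable {E : Type*} [NormedAddCommGroup E] [InnerProductSpace ℝ E]

/-- The nearest point projection onto a complete convex set is `1`-Lipschitz. -/
theorem exists_lipschitz_nearest_point {K : Set E} (hne : K.Nonempty) (hK : IsComplete K)
    (hconv : Convex ℝ K) :
    ∃ π : E → E, LipschitzWith 1 π ∧ (∀ z, π z ∈ K) ∧ ∀ z, ∀ w ∈ K, ⟪z - π z, w - π z⟫ ≤ 0 := by
  choose π hπ hmin using exists_norm_eq_iInf_of_complete_convex hne hK hconv
  have hinner : ∀ z, ∀ w ∈ K, ⟪z - π z, w - π z⟫ ≤ 0 := fun z =>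
    (norm_eq_iInf_iff_real_inner_le_zero hconv (hπ z)).1 (hmin z)
  refine ⟨π, LipschitzWith.of_dist_le_mul fun a b => ?_, hπ, hinner⟩
  rw [NNReal.coe_one, one_mul, dist_eq_norm, dist_eq_norm]
  have h1 := hinner a (π b) (hπ b)
  have h2 := hinner b (π a) (hπ a)
  have h3 : ‖π a - π b‖ ^ 2 ≤ ⟪a - b, π a - π b⟫ := by
    rw [← real_inner_self_eq_norm_sq]
    simp only [inner_sub_left, inner_sub_right] at h1 h2 ⊢
    linarith
  have h4 := real_inner_le_norm (a - b) (π a - π b)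
  by_contra! h
  nlinarith [norm_nonneg (a - b), norm_nonneg (π a - π b)]

/-- Curves outside the open `R`-neighbourhood of a convex set can be pushed onto its boundary
without increasing their length. -/
theorem lengthDist_infDist_eq_le [CompleteSpace E] {P : Set E} (hP : Convex ℝ P)
    (hne : P.Nonempty) {R : ℝ} (hR : 0 ≤ R) {x y : E} (hx : infDist x P = R)
    (hy : infDist y P = R) :
    lengthDist {z | infDist z P = R} x y ≤ lengthDist {z | R ≤ infDist z P} x y := by
  have hmemK : ∀ z, z ∈ cthickening R P ↔ infDist z P ≤ R := fun z => by
    rw [mem_cthickening_iff, infDist, ENNReal.le_ofReal_iff_toReal_le (infEDist_ne_top hne) hR]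
  obtain ⟨π, hLip, hmem, hinner⟩ := exists_lipschitz_nearest_point
    (hne.mono (self_subset_cthickening P)) (isClosed_cthickening (δ := R) (E := P)).isComplete
    (hP.cthickening R)
  have hfix : ∀ z, infDist z P ≤ R → π z = z := fun z hz => by
    have := hinner z z ((hmemK z).2 hz)
    rw [real_inner_self_nonpos, sub_eq_zero] at this
    exact this.symm
  have hbdry : ∀ z, R ≤ infDist z P → infDist (π z) P = R := by
    intro z hz
    refine le_antisymm ((hmemK _).1 (hmem z)) (not_lt.1 fun hlt => ?_)
    have hcont : Continuous fun t : ℝ => infDist (π z + t • (z - π z)) P :=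
      (continuous_infDist_pt P).comp (by fun_prop)
    have hev : ∀ᶠ t in nhds (0 : ℝ), infDist (π z + t • (z - π z)) P < R :=
      hcont.continuousAt.eventually_lt continuousAt_const (by simpa using hlt)
    obtain ⟨t, ht, htpos⟩ := ((hev.filter_mono nhdsWithin_le_nhds).and
      (self_mem_nhdsWithin (s := Set.Ioi (0 : ℝ)))).exists
    have h := hinner z _ ((hmemK _).2 ht.le)
    rw [add_sub_cancel_left, inner_smul_right] at h
    have h0 := nonpos_of_mul_nonpos_right h htpos
    rw [real_inner_self_nonpos, sub_eq_zero] at h0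
    rw [← h0] at hlt
    exact hlt.not_ge hz
  refine le_iInf fun γ => le_iInf fun hγ => le_iInf fun h0 => le_iInf fun h1 => le_iInf fun hS => ?_
  refine (lengthDist_le (γ := π ∘ γ) (hLip.continuous.comp_continuousOn hγ)
    (by simp [h0, hfix x hx.le]) (by simp [h1, hfix y hy.le])
    fun t ht => hbdry _ (hS t ht)).trans ?_
  simpa using (hLip.lipschitzOnWith (s := Set.univ)).comp_eVariationOn_le
    (g := γ) (s := Set.Icc 0 1) (Set.mapsTo_univ _ _)

end Projection

section SphereDetour

variable {E : Type*} [NormedAddCommGroup E] [InnerProductSpace ℝ E]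

theorem norm_le_of_mem_segment {p q u w : E} (hp : ‖u‖ ^ 2 ≤ ⟪p, u⟫) (hq : ‖u‖ ^ 2 ≤ ⟪q, u⟫)
    (hw : w ∈ segment ℝ p q) : ‖u‖ ≤ ‖w‖ := by
  obtain ⟨s, t, hs, ht, hst, rfl⟩ := hw
  have h1 : ‖u‖ ^ 2 ≤ ⟪s • p + t • q, u⟫ := by
    rw [inner_add_left, real_inner_smul_left, real_inner_smul_left]
    nlinarith [mul_le_mul_of_nonneg_left hp hs, mul_le_mul_of_nonneg_left hq ht]
  have h2 := real_inner_le_norm (s • p + t • q) u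
  by_contra! h
  nlinarith [norm_nonneg u, norm_nonneg (s • p + t • q)]

theorem lengthDist_le_of_inner_nonneg {S : Set E} {W : Submodule ℝ E} {q a b : E} {R : ℝ}
    (hR : 0 < R) (hS : ∀ w ∈ W, R ≤ ‖w‖ → q + w ∈ S) (ha : a ∈ W) (hb : b ∈ W)
    (haR : ‖a‖ = R) (hbR : ‖b‖ = R) (hab : 0 ≤ ⟪a, b⟫) :
    lengthDist S (q + a) (q + b) ≤ ENNReal.ofReal (2 * ‖a - b‖) := by
  set s := ⟪a, b⟫ with hs
  have hsR : s ≤ R ^ 2 := by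
    have := real_inner_le_norm a b
    rw [haR, hbR] at this
    nlinarith
  have hpos : 0 < R ^ 2 + s := by positivity
  set κ := R ^ 2 / (R ^ 2 + s) with hκ
  have hκs : κ * (R ^ 2 + s) = R ^ 2 := div_mul_cancel₀ _ hpos.ne'
  have hκ2 : 1 / 2 ≤ κ := by
    rw [hκ, div_le_div_iff₀ two_pos hpos]
    linarith
  -- the tangent lines at `a` and `b` meet at `c`
  set c := κ • (a + b) with hc
  have hcW : c ∈ W := W.smul_mem _ (W.add_mem ha hb)
  have haa : ⟪a, a⟫ = R ^ 2 := by rw [real_inner_self_eq_norm_sq, haR]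
  have hbb : ⟪b, b⟫ = R ^ 2 := by rw [real_inner_self_eq_norm_sq, hbR]
  have hba : ⟪b, a⟫ = s := real_inner_comm _ _
  have hca : ⟪c, a⟫ = R ^ 2 := by
    rw [hc, real_inner_smul_left, inner_add_left, haa, hba, hκs]
  have hcb : ⟪c, b⟫ = R ^ 2 := by
    rw [hc, real_inner_smul_left, inner_add_left, hbb, ← hs, add_comm s, hκs]
  have hcc : ‖c‖ ^ 2 = 2 * κ * R ^ 2 := by
    rw [← real_inner_self_eq_norm_sq]
    nth_rw 2 [hc]
    rw [inner_smul_right, inner_add_right, hca, hcb]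
    ring
  have hd : ‖a - b‖ ^ 2 = 2 * R ^ 2 - 2 * s := by
    rw [norm_sub_sq_real, haR, hbR, ← hs]; ring
  have hle : 2 * κ * R ^ 2 - R ^ 2 ≤ 2 * R ^ 2 - 2 * s := by nlinarith
  have h1 : ‖a - c‖ ≤ ‖a - b‖ := by
    refine le_of_sq_le_sq ?_ (norm_nonneg _)
    rw [hd, norm_sub_sq_real, haR, real_inner_comm, hca, hcc]
    linarith
  have h2 : ‖c - b‖ ≤ ‖a - b‖ := by
    refine le_of_sq_le_sq ?_ (norm_nonneg _)
    rw [hd, norm_sub_sq_real, hbR, hcb, hcc]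
    linarith
  rw [two_mul, ENNReal.ofReal_add (norm_nonneg _) (norm_nonneg _)]
  refine (lengthDist_triangle S _ (q + c) _).trans (add_le_add ?_ ?_)
  · refine (lengthDist_add_left_le fun w hw => hS w (W.convex.segment_subset ha hcW hw) ?_).trans
      (ENNReal.ofReal_le_ofReal h1)
    rw [← haR]
    exact norm_le_of_mem_segment (by rw [haR, haa]) (by rw [haR, hca]) hw
  · refine (lengthDist_add_left_le fun w hw => hS w (W.convex.segment_subset hcW hb hw) ?_).trans
      (ENNReal.ofReal_le_ofReal h2)
    rw [← hbR]
    exact norm_le_of_mem_segment (by rw [hbR, hcb]) (by rw [hbR, hbb]) hw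

theorem lengthDist_le_of_exists_orthogonal {S : Set E} {W : Submodule ℝ E} {q a b : E} {R : ℝ}
    (hR : 0 < R) (hS : ∀ w ∈ W, R ≤ ‖w‖ → q + w ∈ S) (ha : a ∈ W) (hb : b ∈ W)
    (haR : ‖a‖ = R) (hbR : ‖b‖ = R)
    (hab : 0 ≤ ⟪a, b⟫ ∨ ∃ g ∈ W, g ≠ 0 ∧ ⟪a, g⟫ = 0) :
    lengthDist S (q + a) (q + b) ≤ ENNReal.ofReal (4 * ‖a - b‖) := by
  by_cases h0 : 0 ≤ ⟪a, b⟫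
  · exact (lengthDist_le_of_inner_nonneg hR hS ha hb haR hbR h0).trans
      (ENNReal.ofReal_le_ofReal (by linarith [norm_nonneg (a - b)]))
  obtain ⟨g, hgW, hg0, hag⟩ := hab.resolve_left h0
  obtain ⟨g, hgW, hgR, hag, hgb⟩ : ∃ g ∈ W, ‖g‖ = R ∧ ⟪a, g⟫ = 0 ∧ 0 ≤ ⟪g, b⟫ := by
    have hn : ‖(R / ‖g‖) • g‖ = R := by
      rw [norm_smul, Real.norm_of_nonneg (by positivity), div_mul_cancel₀ _ (norm_ne_zero_iff.2 hg0)]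
    have ho : ⟪a, (R / ‖g‖) • g⟫ = 0 := by rw [inner_smul_right, hag, mul_zero]
    have hm : (R / ‖g‖) • g ∈ W := W.smul_mem _ hgW
    rcases le_total 0 ⟪(R / ‖g‖) • g, b⟫ with h | h
    · exact ⟨_, hm, hn, ho, h⟩
    · exact ⟨-((R / ‖g‖) • g), W.neg_mem hm, by rw [norm_neg, hn],
        by rw [inner_neg_right, ho, neg_zero], by rw [inner_neg_left]; linarith⟩
  push Not at h0
  have h1 : ‖a - g‖ ≤ ‖a - b‖ := by
    refine le_of_sq_le_sq ?_ (norm_nonneg _)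
    rw [norm_sub_sq_real, norm_sub_sq_real, hag, haR, hgR, hbR]
    linarith
  have h2 : ‖g - b‖ ≤ ‖a - b‖ := by
    refine le_of_sq_le_sq ?_ (norm_nonneg _)
    rw [norm_sub_sq_real, norm_sub_sq_real, haR, hgR, hbR]
    linarith
  calc lengthDist S (q + a) (q + b)
      ≤ lengthDist S (q + a) (q + g) + lengthDist S (q + g) (q + b) := lengthDist_triangle _ _ _ _
    _ ≤ ENNReal.ofReal (2 * ‖a - g‖) + ENNReal.ofReal (2 * ‖g - b‖) :=
        add_le_add (lengthDist_le_of_inner_nonneg hR hS ha hgW haR hgR hag.ge)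
          (lengthDist_le_of_inner_nonneg hR hS hgW hb hgR hbR hgb)
    _ ≤ ENNReal.ofReal (4 * ‖a - b‖) := by
        rw [← ENNReal.ofReal_add (by positivity) (by positivity)]
        exact ENNReal.ofReal_le_ofReal (by linarith)

end SphereDetour

section AffineSpan

variable {E : Type*} [NormedAddCommGroup E] [InnerProductSpace ℝ E]

theorem sub_mem_orthogonal_of_dist_eq_infDist {Φ : AffineSubspace ℝ E} {x x' : E} (hx' : x' ∈ Φ)
    (h : dist x x' = infDist x (Φ : Set E)) : x - x' ∈ Φ.directionᗮ := by
  rw [infDist_eq_iInf] at h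
  simp only [dist_eq_norm] at h
  have hle := (norm_eq_iInf_iff_real_inner_le_zero Φ.convex hx').1 h
  rw [Submodule.mem_orthogonal']
  intro d hd
  have h1 := hle (d +ᵥ x') (AffineSubspace.vadd_mem_of_mem_direction hd hx')
  have h2 := hle (-d +ᵥ x')
    (AffineSubspace.vadd_mem_of_mem_direction (Submodule.neg_mem _ hd) hx')
  simp only [vadd_eq_add, add_sub_cancel_right, inner_neg_right] at h1 h2
  linarith

theorem norm_add_sub_sq_of_mem_orthogonal {Φ : AffineSubspace ℝ E} {q p w : E} (hq : q ∈ Φ)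
    (hp : p ∈ Φ) (hw : w ∈ Φ.directionᗮ) : ‖q + w - p‖ ^ 2 = ‖q - p‖ ^ 2 + ‖w‖ ^ 2 := by
  have h0 : ⟪q - p, w⟫ = 0 :=
    (Submodule.mem_orthogonal _ _).1 hw _ (AffineSubspace.vsub_mem_direction hq hp)
  rw [add_sub_right_comm, norm_add_sq_real, h0]
  ring

theorem le_infDist_add_of_mem_orthogonal {P : Set E} (hne : P.Nonempty) {q w : E} {R : ℝ}
    (hq : q ∈ affineSpan ℝ P) (hw : w ∈ (affineSpan ℝ P).directionᗮ)
    (h : ∀ p ∈ P, R ^ 2 ≤ ‖q - p‖ ^ 2 + ‖w‖ ^ 2) : R ≤ infDist (q + w) P := by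
  refine (le_infDist hne).2 fun p hp => ?_
  rw [dist_eq_norm]
  refine le_of_sq_le_sq ?_ (norm_nonneg _)
  rw [norm_add_sub_sq_of_mem_orthogonal hq (subset_affineSpan ℝ P hp) hw]
  exact h p hp

theorem le_infDist_of_mem_vertical_segment {P : Set E} (hne : P.Nonempty) {x' u a : E} {R : ℝ}
    (hx' : x' ∈ affineSpan ℝ P) (hu : u ∈ (affineSpan ℝ P).directionᗮ)
    (ha : a ∈ (affineSpan ℝ P).directionᗮ) (hR : infDist (x' + u) P = R) (huR : ‖u‖ ≤ R)
    (hau : ⟪a, u⟫ = R * ‖u‖) :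
    ∀ w ∈ segment ℝ u a, x' + w ∈ {z | R ≤ infDist z P} := by
  intro w hw
  have huw : ‖u‖ ≤ ‖w‖ := by
    refine norm_le_of_mem_segment (real_inner_self_eq_norm_sq u).ge ?_ hw
    rw [hau]
    nlinarith [norm_nonneg u]
  refine le_infDist_add_of_mem_orthogonal hne hx'
    ((affineSpan ℝ P).directionᗮ.convex.segment_subset hu ha hw) fun p hp => ?_
  have h1 : R ≤ ‖x' + u - p‖ := by
    rw [← hR, ← dist_eq_norm]
    exact infDist_le_dist_of_mem hp
  have h2 := norm_add_sub_sq_of_mem_orthogonal hx' (subset_affineSpan ℝ P hp) hu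
  have h0 : 0 ≤ R := (norm_nonneg u).trans huR
  nlinarith [norm_nonneg u, pow_le_pow_left₀ h0 h1 2, pow_le_pow_left₀ (norm_nonneg u) huw 2]

theorem lengthDist_le_of_radial {P : Set E} (hne : P.Nonempty) {x' y' u v a b p : E} {R : ℝ}
    (hR : 0 < R) (hx' : x' ∈ affineSpan ℝ P) (hy' : y' ∈ affineSpan ℝ P)
    (hu : u ∈ (affineSpan ℝ P).directionᗮ) (hv : v ∈ (affineSpan ℝ P).directionᗮ)
    (ha : a ∈ (affineSpan ℝ P).directionᗮ) (hb : b ∈ (affineSpan ℝ P).directionᗮ)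
    (hx : infDist (x' + u) P = R) (hy : infDist (y' + v) P = R)
    (haR : ‖a‖ = R) (hbR : ‖b‖ = R) (hau : ⟪a, u⟫ = R * ‖u‖) (hbv : ⟪b, v⟫ = R * ‖v‖)
    (hp : p ∈ P) (hpseg : p ∈ segment ℝ x' y')
    (hab : 0 ≤ ⟪a, b⟫ ∨ ∃ g ∈ (affineSpan ℝ P).directionᗮ, g ≠ 0 ∧ ⟪a, g⟫ = 0) :
    lengthDist {z | R ≤ infDist z P} (x' + u) (y' + v) ≤
      ENNReal.ofReal (10 * dist (x' + u) (y' + v)) := by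
  set S := {z | R ≤ infDist z P}
  have height : ∀ {q w : E}, q ∈ affineSpan ℝ P → w ∈ (affineSpan ℝ P).directionᗮ →
      infDist (q + w) P = R → ‖w‖ ≤ R ∧ R ≤ ‖w‖ + dist q p := by
    intro q w hq hw hd
    constructor
    · rw [← hd, le_infDist hne]
      intro r hr
      rw [dist_eq_norm]
      refine le_of_sq_le_sq ?_ (norm_nonneg _)
      rw [norm_add_sub_sq_of_mem_orthogonal hq (subset_affineSpan ℝ P hr) hw]
      nlinarith [sq_nonneg ‖q - r‖]
    · rw [← hd, dist_eq_norm]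
      refine (infDist_le_dist_of_mem hp).trans ?_
      rw [dist_eq_norm, add_sub_right_comm, add_comm]
      exact norm_add_le _ _
  have radial : ∀ {w c : E}, ‖w‖ ≤ R → ‖c‖ = R → ⟪c, w⟫ = R * ‖w‖ → ‖w - c‖ = R - ‖w‖ := by
    intro w c hw hc hcw
    refine (sq_eq_sq₀ (norm_nonneg _) (by linarith)).1 ?_
    rw [norm_sub_sq_real, real_inner_comm, hcw, hc]
    ring
  obtain ⟨huR, huR'⟩ := height hx' hu hx
  obtain ⟨hvR, hvR'⟩ := height hy' hv hy
  have hua := radial huR haR hau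
  have hvb := radial hvR hbR hbv
  have hsum : dist x' p + dist y' p = dist x' y' := by
    rw [dist_comm y' p]
    exact dist_add_dist_of_mem_segment hpseg
  have horth : dist (x' + u) (y' + v) ^ 2 = dist x' y' ^ 2 + ‖u - v‖ ^ 2 := by
    rw [dist_eq_norm, dist_eq_norm, ← norm_add_sub_sq_of_mem_orthogonal hx' hy'
      (Submodule.sub_mem _ hu hv)]
    congr 2
    abel
  have hd1 : dist x' y' ≤ dist (x' + u) (y' + v) :=
    le_of_sq_le_sq (by nlinarith [sq_nonneg ‖u - v‖]) dist_nonneg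
  have hd2 : ‖u - v‖ ≤ dist (x' + u) (y' + v) :=
    le_of_sq_le_sq (by nlinarith [sq_nonneg (dist x' y')]) dist_nonneg
  have hab' : ‖a - b‖ ≤ ‖u - a‖ + ‖u - v‖ + ‖v - b‖ := by
    have : a - b = -(u - a) + (u - v) + (v - b) := by abel
    rw [this, ← norm_neg (u - a)]
    exact norm_add₃_le
  have hhigh : ∀ q ∈ affineSpan ℝ P, ∀ w ∈ (affineSpan ℝ P).directionᗮ, R ≤ ‖w‖ → q + w ∈ S := by
    intro q hq w hw hwR
    refine le_infDist_add_of_mem_orthogonal hne hq hw fun r _ => ?_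
    nlinarith [sq_nonneg ‖q - r‖, pow_le_pow_left₀ hR.le hwR 2]
  have hup : lengthDist S (x' + u) (x' + a) ≤ ENNReal.ofReal ‖u - a‖ :=
    lengthDist_add_left_le (le_infDist_of_mem_vertical_segment hne hx' hu ha hx huR hau)
  have hdown : lengthDist S (y' + b) (y' + v) ≤ ENNReal.ofReal ‖v - b‖ := by
    rw [norm_sub_rev]
    refine lengthDist_add_left_le fun w hw => ?_
    rw [segment_symm] at hw
    exact le_infDist_of_mem_vertical_segment hne hy' hv hb hy hvR hbv w hw
  have hacross : lengthDist S (x' + a) (y' + a) ≤ ENNReal.ofReal (dist x' y') := by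
    rw [add_comm x', add_comm y', dist_eq_norm]
    refine lengthDist_add_left_le fun w hw => ?_
    rw [add_comm]
    exact hhigh w ((affineSpan ℝ P).convex.segment_subset hx' hy' hw) a ha haR.ge
  have hturn : lengthDist S (y' + a) (y' + b) ≤ ENNReal.ofReal (4 * ‖a - b‖) :=
    lengthDist_le_of_exists_orthogonal hR (hhigh y' hy') ha hb haR hbR hab
  calc lengthDist S (x' + u) (y' + v)
      ≤ lengthDist S (x' + u) (x' + a) + (lengthDist S (x' + a) (y' + a) +
          (lengthDist S (y' + a) (y' + b) + lengthDist S (y' + b) (y' + v))) := by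
        refine (lengthDist_triangle _ _ (x' + a) _).trans (add_le_add_right ?_ _)
        refine (lengthDist_triangle _ _ (y' + a) _).trans (add_le_add_right ?_ _)
        exact lengthDist_triangle _ _ _ _
    _ ≤ ENNReal.ofReal ‖u - a‖ + (ENNReal.ofReal (dist x' y') +
          (ENNReal.ofReal (4 * ‖a - b‖) + ENNReal.ofReal ‖v - b‖)) := by gcongr
    _ ≤ ENNReal.ofReal (10 * dist (x' + u) (y' + v)) := by
        rw [← ENNReal.ofReal_add (by positivity) (by positivity),
          ← ENNReal.ofReal_add (by positivity) (by positivity),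
          ← ENNReal.ofReal_add (by positivity) (by positivity)]
        exact ENNReal.ofReal_le_ofReal (by linarith)

/-- Directions of norm `R` along `u` and `v`, chosen freely when `u` or `v` vanishes. -/
theorem exists_radial_pair {W : Submodule ℝ E} (hW : W ≠ ⊥) {u v : E} (hu : u ∈ W) (hv : v ∈ W)
    {R : ℝ} (hR : 0 < R)
    (huv : u ≠ 0 → 0 ≤ ⟪u, v⟫ ∨ ∃ g ∈ W, g ≠ 0 ∧ ⟪u, g⟫ = 0) :
    ∃ a ∈ W, ∃ b ∈ W, ‖a‖ = R ∧ ‖b‖ = R ∧ ⟪a, u⟫ = R * ‖u‖ ∧ ⟪b, v⟫ = R * ‖v‖ ∧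
      (0 ≤ ⟪a, b⟫ ∨ ∃ g ∈ W, g ≠ 0 ∧ ⟪a, g⟫ = 0) := by
  have scale : ∀ w ∈ W, w ≠ 0 → (R / ‖w‖) • w ∈ W ∧ ‖(R / ‖w‖) • w‖ = R ∧
      ⟪(R / ‖w‖) • w, w⟫ = R * ‖w‖ := by
    intro w hw hw0
    have hn : ‖w‖ ≠ 0 := norm_ne_zero_iff.2 hw0
    refine ⟨W.smul_mem _ hw, ?_, ?_⟩
    · rw [norm_smul, Real.norm_of_nonneg (by positivity), div_mul_cancel₀ _ hn]
    · rw [real_inner_smul_left, real_inner_self_eq_norm_sq]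
      field_simp
  by_cases hu0 : u = 0
  · obtain ⟨w, hw, hw0, hwv⟩ : ∃ w ∈ W, w ≠ 0 ∧ (v = 0 ∨ w = v) := by
      by_cases hv0 : v = 0
      · obtain ⟨w, hw, hw0⟩ := W.exists_mem_ne_zero_of_ne_bot hW
        exact ⟨w, hw, hw0, .inl hv0⟩
      · exact ⟨v, hv, hv0, .inr rfl⟩
    obtain ⟨hm, hn, hi⟩ := scale w hw hw0
    refine ⟨_, hm, _, hm, hn, hn, by simp [hu0], ?_, .inl real_inner_self_nonneg⟩
    rcases hwv with rfl | rfl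
    · simp
    · exact hi
  obtain ⟨hma, hna, hia⟩ := scale u hu hu0
  by_cases hv0 : v = 0
  · exact ⟨_, hma, _, hma, hna, hna, hia, by simp [hv0], .inl real_inner_self_nonneg⟩
  obtain ⟨hmb, hnb, hib⟩ := scale v hv hv0
  refine ⟨_, hma, _, hmb, hna, hnb, hia, hib, (huv hu0).imp (fun h => ?_) ?_⟩
  · rw [real_inner_smul_left, inner_smul_right]
    positivity
  · rintro ⟨g, hg, hg0, h⟩
    exact ⟨g, hg, hg0, by rw [real_inner_smul_left, h, mul_zero]⟩

theorem exists_mem_orthogonal_inner_eq_zero [FiniteDimensional ℝ E] {V : Submodule ℝ E}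
    (hV : Module.finrank ℝ V + 2 ≤ Module.finrank ℝ E) (u : E) :
    ∃ g ∈ Vᗮ, g ≠ 0 ∧ ⟪u, g⟫ = 0 := by
  have hlt : Module.finrank ℝ ↥(V ⊔ Submodule.span ℝ {u}) < Module.finrank ℝ E := by
    have h1 := Submodule.finrank_add_le_finrank_add_finrank V (Submodule.span ℝ {u})
    have h2 := finrank_span_le_card (R := ℝ) ({u} : Set E)
    rw [Set.toFinset_singleton, Finset.card_singleton] at h2
    omega
  have hne : (V ⊔ Submodule.span ℝ {u})ᗮ ≠ ⊥ := by
    rw [Ne, Submodule.orthogonal_eq_bot_iff]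
    intro h
    rw [h, finrank_top] at hlt
    exact hlt.false
  obtain ⟨g, hg, hg0⟩ := Submodule.exists_mem_ne_zero_of_ne_bot hne
  exact ⟨g, Submodule.orthogonal_le le_sup_left hg, hg0,
    (Submodule.mem_orthogonal _ _).1 hg u
      (Submodule.mem_sup_right (Submodule.mem_span_singleton_self u))⟩

theorem inner_nonneg_of_not_sOppSide [FiniteDimensional ℝ E] {Φ : AffineSubspace ℝ E}
    (hΦ : Module.finrank ℝ Φ.direction + 1 = Module.finrank ℝ E) {x' y' u v : E}
    (hx' : x' ∈ Φ) (hy' : y' ∈ Φ) (hu : u ∈ Φ.directionᗮ) (hv : v ∈ Φ.directionᗮ)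
    (h : ¬ Φ.SOppSide (x' + u) (y' + v)) : 0 ≤ ⟪u, v⟫ := by
  by_contra! hlt
  have hu0 : u ≠ 0 := by rintro rfl; simp at hlt
  have hv0 : v ≠ 0 := by rintro rfl; simp at hlt
  have hnotMem : ∀ {q w : E}, q ∈ Φ → w ∈ Φ.directionᗮ → w ≠ 0 → q + w ∉ Φ := by
    intro q w hq hw hw0 hmem
    have hd : w ∈ Φ.direction := by simpa using AffineSubspace.vsub_mem_direction hmem hq
    exact hw0 (inner_self_eq_zero (𝕜 := ℝ).1 ((Submodule.mem_orthogonal _ _).1 hw w hd))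
  have hfin : Module.finrank ℝ Φ.directionᗮ = 1 := by
    have := Φ.direction.finrank_add_finrank_orthogonal
    omega
  obtain ⟨c, hc⟩ := (finrank_eq_one_iff_of_nonzero' (⟨u, hu⟩ : Φ.directionᗮ)
    (by simpa using hu0)).1 hfin ⟨v, hv⟩
  obtain rfl : c • u = v := congrArg Subtype.val hc
  have hc0 : c < 0 := by
    rw [inner_smul_right, real_inner_self_eq_norm_sq] at hlt
    exact neg_of_mul_neg_left hlt (sq_nonneg _)
  refine h ⟨⟨x', hx', y', hy', ?_⟩, hnotMem hx' hu hu0, hnotMem hy' hv hv0⟩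
  have : y' -ᵥ (y' + c • u) = (-c) • u := by simp
  rw [this, vsub_eq_sub, add_sub_cancel_left]
  exact SameRay.sameRay_nonneg_smul_right u (by linarith)

end AffineSpan

theorem IsPolyhedron.convex {n : ℕ} {P : Set (EuclideanSpace ℝ (Fin n))} (hP : IsPolyhedron P) :
    Convex ℝ P := by
  obtain ⟨k, v, c, rfl⟩ := hP
  rw [Set.ofPred_forall]
  exact convex_iInter fun i => convex_halfSpace_le (innerₛₗ ℝ (v i)).isLinear (c i)

/-- Lemma (non-separating case): for a convex polytope `P` with affine span `Φ` a
proper subspace (`P` of codimension at least 2, or of codimension 1 with `P ≠ Φ`),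
points `x, y ∈ ∂N_R(P)` whose projections `x', y'` on `Φ` span a segment meeting `P`,
such that `Φ` has codimension at least 2 or does not separate `x` and `y`, satisfy
`k₁·d(x,y) ≤ d_ℓ(x,y) ≤ k₂·d(x,y)` for universal constants `k₁, k₂ > 0`. -/
theorem length_metric_comparable_nonseparating :
    ∃ k₁ k₂ : ℝ, 0 < k₁ ∧ 0 < k₂ ∧
    ∀ (n : ℕ), 2 ≤ n →
    ∀ P : Set (EuclideanSpace ℝ (Fin n)), IsPolyhedron P → P.Nonempty →
      ((Module.finrank ℝ (affineSpan ℝ P).direction + 2 ≤ n) ∨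
        (Module.finrank ℝ (affineSpan ℝ P).direction + 1 = n ∧
          P ≠ (affineSpan ℝ P : Set (EuclideanSpace ℝ (Fin n))))) →
    ∀ R : ℝ, 0 < R →
    ∀ x y : EuclideanSpace ℝ (Fin n),
      infDist x P = R → infDist y P = R →
    ∀ x' ∈ (affineSpan ℝ P : Set (EuclideanSpace ℝ (Fin n))),
      dist x x' = infDist x (affineSpan ℝ P : Set (EuclideanSpace ℝ (Fin n))) →
    ∀ y' ∈ (affineSpan ℝ P : Set (EuclideanSpace ℝ (Fin n))),
      dist y y' = infDist y (affineSpan ℝ P : Set (EuclideanSpace ℝ (Fin n))) →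
      (segment ℝ x' y' ∩ P).Nonempty →
      ((Module.finrank ℝ (affineSpan ℝ P).direction + 2 ≤ n) ∨
        (Module.finrank ℝ (affineSpan ℝ P).direction + 1 = n ∧
          ¬ (affineSpan ℝ P).SOppSide x y)) →
      ENNReal.ofReal (k₁ * dist x y) ≤ lengthDist {z | infDist z P = R} x y ∧
      lengthDist {z | infDist z P = R} x y ≤ ENNReal.ofReal (k₂ * dist x y) := by
  refine ⟨1, 10, one_pos, by norm_num, ?_⟩
  intro n _ P hP hne _ R hR x y hx hy x' hx' hxx' y' hy' hyy' hseg hcodim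
  obtain ⟨p, hpseg, hp⟩ := hseg
  rw [SetLike.mem_coe] at hx' hy'
  refine ⟨?_, (lengthDist_infDist_eq_le hP.convex hne hR.le hx hy).trans ?_⟩
  · rw [one_mul, ← edist_dist]
    exact edist_le_lengthDist _ _ _
  have hu := sub_mem_orthogonal_of_dist_eq_infDist hx' hxx'
  have hv := sub_mem_orthogonal_of_dist_eq_infDist hy' hyy'
  obtain ⟨u, rfl⟩ : ∃ u, x = x' + u := ⟨x - x', by abel⟩
  obtain ⟨v, rfl⟩ : ∃ v, y = y' + v := ⟨y - y', by abel⟩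
  rw [add_sub_cancel_left] at hu hv
  have hn : Module.finrank ℝ (EuclideanSpace ℝ (Fin n)) = n := finrank_euclideanSpace_fin
  have hW : (affineSpan ℝ P).directionᗮ ≠ ⊥ := by
    rw [Ne, Submodule.orthogonal_eq_bot_iff]
    intro h
    rw [h, finrank_top, hn] at hcodim
    omega
  obtain ⟨a, ha, b, hb, haR, hbR, hau, hbv, hab⟩ := exists_radial_pair hW hu hv hR fun _ =>
    hcodim.symm.imp
      (fun h => inner_nonneg_of_not_sOppSide (by rw [hn]; exact h.1) hx' hy' hu hv h.2)
      (fun h => exists_mem_orthogonal_inner_eq_zero (by rw [hn]; exact h) u)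
  exact lengthDist_le_of_radial hne hR hx' hy' hu hv ha hb hx hy haR hbR hau hbv hp hpseg hab
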